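/- arXiv:1901.00214 — 3 statements merged into one kernel-verified Lean document; each statement's English description precedes it below -/
import Mathlib

section
/- Fix ρ > 0, let the dataset contain at least K distinct points, let the communication graph be connected, and let the step size α satisfy 0 < α < d_min/((1/ρ)N* + λ_M(L)). Let (x_t, C_t) be any sequence generated by the NK-means algorithm. Then the sequence of cluster centers x_t converges, as t → ∞, to a generalized Lloyd's minimum x̆ of Q^ρ (i.e. x̆ ∈ M^ρ); furthermore, the clusterings C_t converge in finite time to the set of optimal clusterings under x̆: there exists a finite T > 0 such that C_t ∈ U_x̆ for all t ≥ T. -/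
open scoped BigOperators

noncomputable section

/-! ### Basic (centralized) K-means notions -/

/-- The dataset `D` contains at least `K` distinct points. -/
def HasKDistinct {p : ℕ} (K : ℕ) (D : Multiset (EuclideanSpace ℝ (Fin p))) : Prop :=
  ∃ S : Finset (EuclideanSpace ℝ (Fin p)), S.card = K ∧ ∀ y ∈ S, y ∈ D

/-- The K-means clustering cost `F(x) = ∑_{y ∈ D} min_k ‖y - x^k‖²`. -/
def kmeansF {p : ℕ} (K : ℕ) (D : Multiset (EuclideanSpace ℝ (Fin p)))
    (x : Fin K → EuclideanSpace ℝ (Fin p)) : ℝ :=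
  (D.map fun y => ⨅ k : Fin K, ‖y - x k‖ ^ 2).sum

/-- `P` is a partition of the multiset `D` into `K` (possibly empty) cells. -/
def IsKPartition {p K : ℕ} (D : Multiset (EuclideanSpace ℝ (Fin p)))
    (P : Fin K → Multiset (EuclideanSpace ℝ (Fin p))) : Prop :=
  ∑ k, P k = D

/-- The distortion cost `H(x, P) = ∑_k ∑_{y ∈ P^k} ‖y - x^k‖²`. -/
def costH {p K : ℕ} (x : Fin K → EuclideanSpace ℝ (Fin p))
    (P : Fin K → Multiset (EuclideanSpace ℝ (Fin p))) : ℝ :=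
  ∑ k, ((P k).map fun y => ‖y - x k‖ ^ 2).sum

/-- `(x, P)` is a Lloyd's minimum for the dataset `D`. -/
def IsLloydMin {p K : ℕ} (D : Multiset (EuclideanSpace ℝ (Fin p)))
    (x : Fin K → EuclideanSpace ℝ (Fin p))
    (P : Fin K → Multiset (EuclideanSpace ℝ (Fin p))) : Prop :=
  IsKPartition D P ∧
    (∀ Q, IsKPartition D Q → costH x P ≤ costH x Q) ∧
    (∀ x', costH x P ≤ costH x' P)

/-- The set `Z` of Lloyd's minima (cluster-center tuples). -/
def LloydZ {p : ℕ} (K : ℕ) (D : Multiset (EuclideanSpace ℝ (Fin p))) :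
    Set (Fin K → EuclideanSpace ℝ (Fin p)) :=
  {x | ∃ P, IsLloydMin D x P}

/-- The set `Z̄` of Lloyd's minima whose centers lie in the (closed) convex hull of `D`. -/
def LloydZbar {p : ℕ} (K : ℕ) (D : Multiset (EuclideanSpace ℝ (Fin p))) :
    Set (Fin K → EuclideanSpace ℝ (Fin p)) :=
  {x ∈ LloydZ K D | ∀ k, x k ∈ convexHull ℝ {y | y ∈ D}}

/-- The set `Z_g` of global minimizers of the K-means cost `F`. -/
def kmeansZg {p : ℕ} (K : ℕ) (D : Multiset (EuclideanSpace ℝ (Fin p))) :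
    Set (Fin K → EuclideanSpace ℝ (Fin p)) :=
  {x | ∀ x', kmeansF K D x ≤ kmeansF K D x'}

/-- The global minimum value `F*` of the K-means cost. -/
def Fstar {p : ℕ} (K : ℕ) (D : Multiset (EuclideanSpace ℝ (Fin p))) : ℝ :=
  sInf (Set.range (kmeansF K D))

/-- `R₀ = max{‖v‖ : v ∈ closed convex hull of D}`. -/
def R0 {p : ℕ} (D : Multiset (EuclideanSpace ℝ (Fin p))) : ℝ :=
  sSup ((fun v => ‖v‖) '' convexHull ℝ {y | y ∈ D})

/-! ### Multi-agent notions -/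

section Distributed

variable {p K M : ℕ}

/-- The multi-agent cost `J^ρ(x, C)`; each undirected edge is counted once in the
agreement term. -/
def costJ (ρ : ℝ) (G : SimpleGraph (Fin M)) [DecidableRel G.Adj]
    (x : Fin M → Fin K → EuclideanSpace ℝ (Fin p))
    (C : Fin M → Fin K → Multiset (EuclideanSpace ℝ (Fin p))) : ℝ :=
  (1 / ρ) * ∑ m, ∑ k, ((C m k).map fun y => ‖y - x m k‖ ^ 2).sum +
    (1 / 2) * ∑ m, ∑ l ∈ G.neighborFinset m, ∑ k, ‖x m k - x l k‖ ^ 2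

/-- The multi-agent cost `Q^ρ(x)`. -/
def costQ (ρ : ℝ) (G : SimpleGraph (Fin M)) [DecidableRel G.Adj]
    (Dm : Fin M → Multiset (EuclideanSpace ℝ (Fin p)))
    (x : Fin M → Fin K → EuclideanSpace ℝ (Fin p)) : ℝ :=
  (1 / ρ) * ∑ m, ((Dm m).map fun y => ⨅ k : Fin K, ‖y - x m k‖ ^ 2).sum +
    (1 / 2) * ∑ m, ∑ l ∈ G.neighborFinset m, ∑ k, ‖x m k - x l k‖ ^ 2

/-- The set of global minimizers `M^ρ_g` of `Q^ρ`. -/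
def globQ (ρ : ℝ) (G : SimpleGraph (Fin M)) [DecidableRel G.Adj]
    (Dm : Fin M → Multiset (EuclideanSpace ℝ (Fin p))) (K : ℕ) :
    Set (Fin M → Fin K → EuclideanSpace ℝ (Fin p)) :=
  {x | ∀ x' : Fin M → Fin K → EuclideanSpace ℝ (Fin p), costQ ρ G Dm x ≤ costQ ρ G Dm x'}

/-- `C ∈ U_x` : `C` is an admissible (Voronoi / nearest-center) clustering for `x`. -/
def InVoronoi (Dm : Fin M → Multiset (EuclideanSpace ℝ (Fin p)))
    (x : Fin M → Fin K → EuclideanSpace ℝ (Fin p))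
    (C : Fin M → Fin K → Multiset (EuclideanSpace ℝ (Fin p))) : Prop :=
  (∀ m, IsKPartition (Dm m) (C m)) ∧
    ∀ m k y, y ∈ C m k → ∀ k', ‖y - x m k‖ ≤ ‖y - x m k'‖

/-- The fixed-point (stationarity) equations
`((1/ρ)|C_m^k| + |Ω_m|) x_m^k = (1/ρ) ∑_{y ∈ C_m^k} y + ∑_{l ∈ Ω_m} x_l^k`. -/
def IsFixedCenters (ρ : ℝ) (G : SimpleGraph (Fin M)) [DecidableRel G.Adj]
    (x : Fin M → Fin K → EuclideanSpace ℝ (Fin p))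
    (C : Fin M → Fin K → Multiset (EuclideanSpace ℝ (Fin p))) : Prop :=
  ∀ m k, ((1 / ρ) * ((C m k).card : ℝ) + (G.degree m : ℝ)) • x m k =
      (1 / ρ) • (C m k).sum + ∑ l ∈ G.neighborFinset m, x l k

/-- `(x, C)` is a generalized Lloyd's minimum of `J^ρ`. -/
def IsGenLloydMin (ρ : ℝ) (G : SimpleGraph (Fin M)) [DecidableRel G.Adj]
    (Dm : Fin M → Multiset (EuclideanSpace ℝ (Fin p)))
    (x : Fin M → Fin K → EuclideanSpace ℝ (Fin p))
    (C : Fin M → Fin K → Multiset (EuclideanSpace ℝ (Fin p))) : Prop :=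
  InVoronoi Dm x C ∧ IsFixedCenters ρ G x C

/-- The set `M^ρ` of generalized Lloyd's minima (centers part). -/
def genM (ρ : ℝ) (G : SimpleGraph (Fin M)) [DecidableRel G.Adj]
    (Dm : Fin M → Multiset (EuclideanSpace ℝ (Fin p))) (K : ℕ) :
    Set (Fin M → Fin K → EuclideanSpace ℝ (Fin p)) :=
  {x | ∃ C, IsGenLloydMin ρ G Dm x C}

/-- The set `M̄^ρ` of generalized Lloyd's minima with all centers in the (closed)
convex hull of the collective dataset `D`. -/
def genMbar (ρ : ℝ) (G : SimpleGraph (Fin M)) [DecidableRel G.Adj]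
    (Dm : Fin M → Multiset (EuclideanSpace ℝ (Fin p)))
    (D : Multiset (EuclideanSpace ℝ (Fin p))) (K : ℕ) :
    Set (Fin M → Fin K → EuclideanSpace ℝ (Fin p)) :=
  {x ∈ genM ρ G Dm K | ∀ m k, x m k ∈ convexHull ℝ {y | y ∈ D}}

/-- The update target
`μ_m^k = ((1/ρ) ∑_{y ∈ C_m^k} y + ∑_{l ∈ Ω_m} x_l^k) / ((1/ρ)|C_m^k| + |Ω_m|)`. -/
def muVec (ρ : ℝ) (G : SimpleGraph (Fin M)) [DecidableRel G.Adj]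
    (x : Fin M → Fin K → EuclideanSpace ℝ (Fin p))
    (C : Fin M → Fin K → Multiset (EuclideanSpace ℝ (Fin p)))
    (m : Fin M) (k : Fin K) : EuclideanSpace ℝ (Fin p) :=
  ((1 / ρ) * ((C m k).card : ℝ) + (G.degree m : ℝ))⁻¹ •
    ((1 / ρ) • (C m k).sum + ∑ l ∈ G.neighborFinset m, x l k)

/-- `(x_t, C_t)` is a trajectory of the NK-means algorithm with parameters `ρ, α`. -/
def NKMeansSeq (ρ α : ℝ) (G : SimpleGraph (Fin M)) [DecidableRel G.Adj]
    (Dm : Fin M → Multiset (EuclideanSpace ℝ (Fin p)))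
    (x : ℕ → Fin M → Fin K → EuclideanSpace ℝ (Fin p))
    (C : ℕ → Fin M → Fin K → Multiset (EuclideanSpace ℝ (Fin p))) : Prop :=
  (∀ m, IsKPartition (Dm m) (C 0 m)) ∧
    ∀ t, (∀ m, IsKPartition (Dm m) (C (t + 1) m)) ∧
      (∀ m k y, y ∈ C (t + 1) m k → ∀ k', ‖y - x t m k‖ ≤ ‖y - x t m k'‖) ∧
      ∀ m k, x (t + 1) m k = x t m k - α • (x t m k - muVec ρ G (x t) (C (t + 1)) m k)

/-- The minimum vertex degree `d_min` of the communication graph. -/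
def minDeg (G : SimpleGraph (Fin M)) [DecidableRel G.Adj] : ℕ :=
  sInf (Set.range fun m : Fin M => G.degree m)

/-- The largest eigenvalue `λ_M(L)` of the graph Laplacian. -/
def lapLamMax (G : SimpleGraph (Fin M)) [DecidableRel G.Adj] : ℝ :=
  sSup (spectrum ℝ (G.lapMatrix ℝ))

/-- The second-smallest eigenvalue `λ₂(L)` of the graph Laplacian (for a connected
graph, the smallest nonzero eigenvalue). -/
def lapLam2 (G : SimpleGraph (Fin M)) [DecidableRel G.Adj] : ℝ :=
  sInf {μ : ℝ | μ ∈ spectrum ℝ (G.lapMatrix ℝ) ∧ μ ≠ 0}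

/-- `N* = max_m |D_m|`. -/
def Nstar (Dm : Fin M → Multiset (EuclideanSpace ℝ (Fin p))) : ℕ :=
  Finset.univ.sup fun m => (Dm m).card

/-- The step-size condition `0 < α < d_min / ((1/ρ) N* + λ_M(L))`. -/
def StepOK (ρ α : ℝ) (G : SimpleGraph (Fin M)) [DecidableRel G.Adj]
    (Dm : Fin M → Multiset (EuclideanSpace ℝ (Fin p))) : Prop :=
  0 < α ∧ α * ((1 / ρ) * (Nstar Dm : ℝ) + lapLamMax G) < (minDeg G : ℝ)

/-- The constant `c(α) = 2α(d_min − α((1/ρ)N* + λ_M(L)))`. -/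
def cAlpha (ρ α : ℝ) (G : SimpleGraph (Fin M)) [DecidableRel G.Adj]
    (Dm : Fin M → Multiset (EuclideanSpace ℝ (Fin p))) : ℝ :=
  2 * α * ((minDeg G : ℝ) - α * ((1 / ρ) * (Nstar Dm : ℝ) + lapLamMax G))

end Distributed

theorem LinearMap.exists_comp_comp_eq_self {k V W : Type*} [Field k] [AddCommGroup V] [Module k V]
    [AddCommGroup W] [Module k W] (A : V →ₗ[k] W) : ∃ g : W →ₗ[k] V, ∀ e, A (g (A e)) = A e := by
  obtain ⟨h, hh⟩ := A.rangeRestrict.exists_rightInverse_of_surjective A.range_rangeRestrict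
  obtain ⟨g, hg⟩ := LinearMap.exists_extend h
  refine ⟨g, fun e => ?_⟩
  have h1 : g (A e) = h (A.rangeRestrict e) := by
    rw [← hg]; rfl
  rw [h1]
  exact congrArg Subtype.val (LinearMap.congr_fun hh (A.rangeRestrict e))

/-- A symmetric operator on a finite-dimensional space controls its quadratic form by the square of
the norm of its image. -/
theorem exists_abs_form_le_sq_norm {V : Type*} [NormedAddCommGroup V] [NormedSpace ℝ V]
    [FiniteDimensional ℝ V] {P : V → V → ℝ} {c : ℝ} (hP : ∀ u v, |P u v| ≤ c * ‖u‖ * ‖v‖)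
    (A : V →ₗ[ℝ] V) (hA : ∀ u v, P (A u) v = P (A v) u) :
    ∃ κ, ∀ e, |P (A e) e| ≤ κ * ‖A e‖ ^ 2 := by
  obtain ⟨g, hg⟩ := A.exists_comp_comp_eq_self
  refine ⟨|c| * ‖g.toContinuousLinearMap‖, fun e => ?_⟩
  have hge : ‖g (A e)‖ ≤ ‖g.toContinuousLinearMap‖ * ‖A e‖ :=
    g.toContinuousLinearMap.le_opNorm (A e)
  rw [← hg e, hA, hg e]
  calc |P (A e) (g (A e))| ≤ c * ‖A e‖ * ‖g (A e)‖ := hP _ _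
    _ ≤ |c| * ‖A e‖ * (‖g.toContinuousLinearMap‖ * ‖A e‖) := by
      gcongr
      exact le_abs_self c
    _ = _ := by ring

theorem eventually_frequently_eq {ι : Type*} {i : ℕ → ι} (hi : (Set.range i).Finite) :
    ∀ᶠ t in Filter.atTop, ∃ᶠ s in Filter.atTop, i s = i t := by
  have key : ∀ j ∈ Set.range i, ∀ᶠ t in Filter.atTop, i t = j →
      ∃ᶠ s in Filter.atTop, i s = j := by
    intro j _
    by_cases hj : ∃ᶠ s in Filter.atTop, i s = j
    · exact Filter.Eventually.of_forall fun _ _ => hj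
    · filter_upwards [Filter.not_frequently.1 hj] with t ht h
      exact absurd h ht
  filter_upwards [(Filter.eventually_all_finite hi).2 key] with t ht
  exact ht (i t) ⟨t, rfl⟩ rfl

/-- A sequence whose steps are controlled by a linearly convergent decrease is Cauchy. -/
theorem cauchySeq_of_sufficient_decrease {V : Type*} [NormedAddCommGroup V] {x : ℕ → V}
    {D : ℕ → ℝ} {a q : ℝ} (ha : 0 < a) (hD0 : ∀ t, 0 ≤ D t)
    (hdesc : ∀ t, D (t + 1) + a * ‖x (t + 1) - x t‖ ^ 2 ≤ D t)
    (hq : ∀ᶠ t in Filter.atTop, D t ≤ q * ‖x (t + 1) - x t‖ ^ 2) : CauchySeq x := by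
  obtain ⟨T, hT⟩ := Filter.eventually_atTop.1 hq
  set r : ℝ := 1 - a / (|q| + a) with hr
  have hqa : 0 < |q| + a := by positivity
  have hr0 : 0 ≤ r := by
    rw [hr, sub_nonneg, div_le_one hqa]
    linarith [abs_nonneg q]
  have hr1 : r < 1 := by
    rw [hr]
    linarith [div_pos ha hqa]
  have hstep : ∀ t, T ≤ t → D (t + 1) ≤ r * D t := by
    intro t ht
    have h1 : D t ≤ (|q| + a) * ‖x (t + 1) - x t‖ ^ 2 := (hT t ht).trans (by
      gcongr
      linarith [le_abs_self q])
    have h2 : a / (|q| + a) * D t ≤ a * ‖x (t + 1) - x t‖ ^ 2 := by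
      rw [div_mul_eq_mul_div, div_le_iff₀ hqa]
      nlinarith
    rw [hr, sub_mul, one_mul]
    linarith [hdesc t]
  have hgeom : ∀ n, D (T + n) ≤ r ^ n * D T := by
    intro n
    induction n with
    | zero => simp
    | succ n ih =>
      calc D (T + (n + 1)) ≤ r * D (T + n) := hstep (T + n) (by omega)
        _ ≤ r * (r ^ n * D T) := by gcongr
        _ = _ := by ring
  have hshift : CauchySeq fun n => x (n + T) := by
    refine cauchySeq_of_le_geometric (Real.sqrt r) (Real.sqrt (D T / a)) ?_ fun n => ?_
    · rw [Real.sqrt_lt' one_pos]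
      simpa using hr1
    · rw [dist_comm, dist_eq_norm]
      refine abs_le_of_sq_le_sq' ?_ (by positivity) |>.2
      rw [mul_pow, ← pow_mul, mul_comm n 2, pow_mul, Real.sq_sqrt hr0,
        Real.sq_sqrt (div_nonneg (hD0 T) ha.le), div_mul_eq_mul_div, le_div_iff₀ ha]
      have h1 := hdesc (n + T)
      have h2 := hgeom n
      rw [add_comm T n] at h2
      rw [add_right_comm n 1 T]
      linarith [hD0 (n + T + 1)]
  exact (cauchySeq_shift T).1 hshift

/-- Descent with sufficient decrease and relative error along finitely many quadratic functions
`f j`, with gradients `2 (A j · - b j)`, converges to a critical point of a function that is active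
infinitely often. -/
theorem exists_tendsto_of_piecewise_quadratic_descent {V ι : Type*} [NormedAddCommGroup V]
    [NormedSpace ℝ V] [FiniteDimensional ℝ V] {P : V → V → ℝ} {c : ℝ}
    (hP : ∀ u v, |P u v| ≤ c * ‖u‖ * ‖v‖)
    {f : ι → V → ℝ} {A : ι → V →ₗ[ℝ] V} {b : ι → V}
    (hA : ∀ j u v, P (A j u) v = P (A j v) u)
    (hf : ∀ j x y, f j y = f j x + 2 * P (A j x - b j) (y - x) + P (A j (y - x)) (y - x))
    {x : ℕ → V} {i : ℕ → ι} (hi : (Set.range i).Finite) {a L : ℝ} (ha : 0 < a)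
    (hpos : ∀ t, 0 ≤ f (i t) (x t))
    (hdesc : ∀ t, f (i (t + 1)) (x (t + 1)) + a * ‖x (t + 1) - x t‖ ^ 2 ≤ f (i t) (x t))
    (hrel : ∀ t, ‖A (i t) (x t) - b (i t)‖ ≤ L * ‖x (t + 1) - x t‖) :
    ∃ z j, Filter.Tendsto x Filter.atTop (nhds z) ∧ A j z = b j ∧
      ∃ᶠ t in Filter.atTop, i t = j := by
  set J : ℕ → ℝ := fun t => f (i t) (x t) with hJ
  have hanti : Antitone J := antitone_nat_of_succ_le fun t =>
    (le_add_of_nonneg_right (by positivity)).trans (hdesc t)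
  have hbdd : BddBelow (Set.range J) := ⟨0, by rintro _ ⟨t, rfl⟩; exact hpos t⟩
  have hlim := tendsto_atTop_ciInf hanti hbdd
  set J' : ℝ := ⨅ t, J t
  have hle : ∀ t, J' ≤ J t := fun t => ciInf_le hbdd t
  have hdiff : Filter.Tendsto (fun t => (J t - J (t + 1)) / a) Filter.atTop (nhds 0) := by
    have := (hlim.sub (hlim.comp (Filter.tendsto_add_atTop_nat 1))).div_const a
    simpa using this
  have hstep2 : Filter.Tendsto (fun t => ‖x (t + 1) - x t‖ ^ 2) Filter.atTop (nhds 0) := by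
    refine squeeze_zero (fun t => by positivity) (fun t => ?_) hdiff
    rw [le_div_iff₀ ha]
    have := hdesc t
    simp only [hJ]
    linarith
  have hstep : Filter.Tendsto (fun t => ‖x (t + 1) - x t‖) Filter.atTop (nhds 0) := by
    have := hstep2.sqrt
    simpa [Real.sqrt_sq] using this
  have hgrad : Filter.Tendsto (fun t => A (i t) (x t) - b (i t)) Filter.atTop (nhds 0) := by
    refine squeeze_zero_norm hrel ?_
    simpa using hstep.const_mul L
  have hsub : ∀ j, (∃ᶠ s in Filter.atTop, i s = j) → ∃ l : Filter ℕ, l.NeBot ∧ l ≤ Filter.atTop ∧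
      ∀ᶠ s in l, i s = j := fun j hj =>
    ⟨_, Filter.frequently_iff_neBot.1 hj, inf_le_left,
      Filter.mem_inf_of_right (Filter.mem_principal_self _)⟩
  have hPL : ∀ j, (∃ᶠ s in Filter.atTop, i s = j) → ∃ κ, ∀ t, i t = j →
      J t - J' ≤ κ * ‖A (i t) (x t) - b (i t)‖ ^ 2 := by
    intro j hj
    obtain ⟨l, hl, hlt, hlj⟩ := hsub j hj
    have hgj : Filter.Tendsto (fun t => A j (x t) - b j) l (nhds 0) :=
      (hgrad.mono_left hlt).congr' (hlj.mono fun t ht => by simp only [ht])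
    obtain ⟨z, hz⟩ : b j ∈ LinearMap.range (A j) := by
      refine (Submodule.closed_of_finiteDimensional (LinearMap.range (A j))).mem_of_tendsto
        (f := fun t => A j (x t)) (b := l) ?_ (Filter.Eventually.of_forall fun t => ⟨x t, rfl⟩)
      simpa using hgj.add_const (b j)
    obtain ⟨κ, hκ⟩ := exists_abs_form_le_sq_norm hP (A j) (hA j)
    have hval : ∀ t, i t = j → |J t - f j z| ≤ κ * ‖A j (x t) - b j‖ ^ 2 := by
      intro t ht
      have h0 : P 0 (x t - z) = 0 := by simpa using hP 0 (x t - z)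
      have h1 : J t - f j z = P (A j (x t - z)) (x t - z) := by
        simp only [hJ, ht]
        rw [hf j z (x t), hz, sub_self, h0]
        ring
      rw [h1, ← hz, ← map_sub]
      exact hκ _
    have hJz : J' = f j z := by
      refine tendsto_nhds_unique (hlim.mono_left hlt) ?_
      rw [tendsto_iff_norm_sub_tendsto_zero]
      refine squeeze_zero' (Filter.Eventually.of_forall fun t => norm_nonneg _)
        (hlj.mono fun t ht => hval t ht) ?_
      simpa using (hgj.norm.pow 2).const_mul κ
    refine ⟨κ, fun t ht => ?_⟩
    rw [hJz, ht]
    exact (le_abs_self _).trans (hval t ht)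
  have hPL' : ∃ κ, 0 ≤ κ ∧ ∀ᶠ t in Filter.atTop,
      J t - J' ≤ κ * ‖A (i t) (x t) - b (i t)‖ ^ 2 := by
    have hex : ∀ j, ∃ κ, (∃ᶠ s in Filter.atTop, i s = j) → ∀ t, i t = j →
        J t - J' ≤ κ * ‖A (i t) (x t) - b (i t)‖ ^ 2 := by
      intro j
      by_cases hj : ∃ᶠ s in Filter.atTop, i s = j
      · obtain ⟨κ, h⟩ := hPL j hj
        exact ⟨κ, fun _ => h⟩
      · exact ⟨0, fun h => absurd h hj⟩
    choose κ hκ using hex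
    obtain ⟨B, hB⟩ := (hi.image κ).bddAbove
    refine ⟨|B|, abs_nonneg B, ?_⟩
    filter_upwards [eventually_frequently_eq hi] with t ht
    refine (hκ (i t) ht t rfl).trans ?_
    gcongr
    exact (hB ⟨i t, ⟨t, rfl⟩, rfl⟩).trans (le_abs_self B)
  obtain ⟨κ, hκ0, hκ⟩ := hPL'
  have hcauchy : CauchySeq x := by
    refine cauchySeq_of_sufficient_decrease (D := fun t => J t - J') (q := κ * L ^ 2) ha
      (fun t => sub_nonneg.2 (hle t)) (fun t => ?_) ?_
    · have := hdesc t
      simp only [hJ]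
      linarith
    · filter_upwards [hκ] with t ht
      refine ht.trans ?_
      rw [mul_assoc, ← mul_pow]
      gcongr
      exact hrel t
  have := FiniteDimensional.complete ℝ V
  obtain ⟨z, hz⟩ := cauchySeq_tendsto_of_complete hcauchy
  obtain ⟨T, hT⟩ := (eventually_frequently_eq hi).exists
  refine ⟨z, i T, hz, ?_, hT⟩
  obtain ⟨l, hl, hlt, hlj⟩ := hsub (i T) hT
  have hgj : Filter.Tendsto (fun t => A (i T) (x t) - b (i T)) l (nhds 0) :=
    (hgrad.mono_left hlt).congr' (hlj.mono fun t ht => by simp only [ht])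
  have hcont : Filter.Tendsto (fun t => A (i T) (x t) - b (i T)) l
      (nhds (A (i T) z - b (i T))) :=
    (((A (i T)).continuous_of_finiteDimensional.tendsto z).comp (hz.mono_left hlt)).sub_const _
  exact sub_eq_zero.1 (tendsto_nhds_unique hcont hgj)

theorem SimpleGraph.sum_neighborFinset_comm {V R : Type*} [Fintype V] [AddCommMonoid R]
    (G : SimpleGraph V) [DecidableRel G.Adj] (g : V → V → R) :
    ∑ m, ∑ l ∈ G.neighborFinset m, g m l = ∑ m, ∑ l ∈ G.neighborFinset m, g l m :=
  Finset.sum_comm' fun m l => by simp [G.adj_comm]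

theorem SimpleGraph.half_sum_inner_sub_sub {V E : Type*} [Fintype V] [NormedAddCommGroup E]
    [InnerProductSpace ℝ E] (G : SimpleGraph V) [DecidableRel G.Adj] (u v : V → E) :
    (1 / 2 : ℝ) * ∑ m, ∑ l ∈ G.neighborFinset m, inner ℝ (u m - u l) (v m - v l) =
      ∑ m, inner ℝ ((G.degree m : ℝ) • u m - ∑ l ∈ G.neighborFinset m, u l) (v m) := by
  have h1 : ∑ m, ∑ l ∈ G.neighborFinset m, inner ℝ (u m - u l) (v m - v l) =
      ∑ m, ∑ l ∈ G.neighborFinset m, inner ℝ (u m - u l) (v m) +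
        ∑ m, ∑ l ∈ G.neighborFinset m, inner ℝ (u l - u m) (v l) := by
    simp only [← Finset.sum_add_distrib]
    refine Finset.sum_congr rfl fun m _ => Finset.sum_congr rfl fun l _ => ?_
    simp only [inner_sub_left, inner_sub_right]
    ring
  have h2 : ∀ m, inner ℝ ((G.degree m : ℝ) • u m - ∑ l ∈ G.neighborFinset m, u l) (v m) =
      ∑ l ∈ G.neighborFinset m, inner ℝ (u m - u l) (v m) := by
    intro m
    rw [← sum_inner, Finset.sum_sub_distrib, Finset.sum_const, G.card_neighborFinset_eq_degree,
      Nat.cast_smul_eq_nsmul]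
  rw [h1, ← G.sum_neighborFinset_comm fun m l => inner ℝ (u m - u l) (v m)]
  simp only [h2]
  ring

theorem SimpleGraph.half_sum_sq_sub_le {M : ℕ} (G : SimpleGraph (Fin M)) [DecidableRel G.Adj]
    (z : Fin M → ℝ) :
    (1 / 2) * ∑ m, ∑ l ∈ G.neighborFinset m, (z m - z l) ^ 2 ≤ lapLamMax G * ∑ m, z m ^ 2 := by
  have hps : (algebraMap ℝ (Matrix (Fin M) (Fin M) ℝ) (lapLamMax G) -
      G.lapMatrix ℝ).PosSemidef := by
    rw [Matrix.posSemidef_iff_isHermitian_and_spectrum_nonneg]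
    refine ⟨?_, ?_⟩
    · rw [Algebra.algebraMap_eq_smul_one]
      exact IsSelfAdjoint.sub (Matrix.isHermitian_one.smul (IsSelfAdjoint.all _))
        (G.posSemidef_lapMatrix ℝ).isHermitian
    · rw [← spectrum.singleton_sub_eq, Set.singleton_sub]
      rintro _ ⟨μ, hμ, rfl⟩
      exact sub_nonneg.2 (le_csSup (Matrix.finite_real_spectrum.bddAbove) hμ)
  have h := hps.dotProduct_mulVec_nonneg z
  have hL := G.lapMatrix_toLinearMap₂' ℝ z
  rw [Matrix.toLinearMap₂'_apply'] at hL
  rw [Matrix.sub_mulVec, dotProduct_sub, star_trivial, hL, Algebra.algebraMap_eq_smul_one,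
    Matrix.smul_mulVec, Matrix.one_mulVec, dotProduct_smul] at h
  have h1 : ∑ m, ∑ l ∈ G.neighborFinset m, (z m - z l) ^ 2 =
      ∑ m, ∑ l, if G.Adj m l then (z m - z l) ^ 2 else 0 := by
    refine Finset.sum_congr rfl fun m _ => ?_
    rw [← Finset.sum_filter, G.neighborFinset_eq_filter]
  have h2 : z ⬝ᵥ z = ∑ m, z m ^ 2 := by simp [dotProduct, sq]
  rw [h1, ← h2]
  rw [smul_eq_mul] at h
  linarith

theorem lapLamMax_nonneg {M : ℕ} (hM : 0 < M) (G : SimpleGraph (Fin M)) [DecidableRel G.Adj] :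
    0 ≤ lapLamMax G := by
  have h := G.half_sum_sq_sub_le fun _ => 1
  have hM' : (0 : ℝ) < M := by exact_mod_cast hM
  simp at h
  exact nonneg_of_mul_nonneg_left h hM'

theorem SimpleGraph.half_sum_sq_norm_sub_le {M p : ℕ} (G : SimpleGraph (Fin M))
    [DecidableRel G.Adj] (u : Fin M → EuclideanSpace ℝ (Fin p)) :
    (1 / 2) * ∑ m, ∑ l ∈ G.neighborFinset m, ‖u m - u l‖ ^ 2 ≤
      lapLamMax G * ∑ m, ‖u m‖ ^ 2 := by
  have h1 : ∑ m, ∑ l ∈ G.neighborFinset m, ‖u m - u l‖ ^ 2 =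
      ∑ i, ∑ m, ∑ l ∈ G.neighborFinset m, (u m i - u l i) ^ 2 := by
    simp only [EuclideanSpace.real_norm_sq_eq, PiLp.sub_apply]
    rw [Finset.sum_comm]
    exact Finset.sum_congr rfl fun m _ => Finset.sum_comm
  have h2 : ∑ m, ‖u m‖ ^ 2 = ∑ i, ∑ m, u m i ^ 2 := by
    simp only [EuclideanSpace.real_norm_sq_eq]
    exact Finset.sum_comm
  rw [h1, h2, Finset.mul_sum, Finset.mul_sum]
  exact Finset.sum_le_sum fun i _ => G.half_sum_sq_sub_le fun m => u m i

theorem Multiset.sum_sq_norm_sub_add {E : Type*} [NormedAddCommGroup E] [InnerProductSpace ℝ E]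
    (s : Multiset E) (x e : E) :
    (s.map fun y => ‖y - (x + e)‖ ^ 2).sum = (s.map fun y => ‖y - x‖ ^ 2).sum +
      2 * inner ℝ ((s.card : ℝ) • x - s.sum) e + s.card * ‖e‖ ^ 2 := by
  induction s using Multiset.induction_on with
  | empty => simp
  | cons y s ih =>
    have h : ‖y - (x + e)‖ ^ 2 = ‖y - x‖ ^ 2 - 2 * inner ℝ (y - x) e + ‖e‖ ^ 2 := by
      rw [← sub_sub, norm_sub_sq_real]
    simp only [Multiset.map_cons, Multiset.sum_cons, Multiset.card_cons, ih, h, Nat.cast_add,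
      Nat.cast_one, inner_sub_left, inner_smul_left, inner_add_left, conj_trivial]
    ring

section NKMeans

variable {p K M : ℕ}

/-- The sum of the inner products of the centers. -/
def centerInner (u v : Fin M → Fin K → EuclideanSpace ℝ (Fin p)) : ℝ :=
  ∑ m, ∑ k, inner ℝ (u m k) (v m k)

/-- The linear part of half the gradient of `costJ` in the centers. -/
def costOp (ρ : ℝ) (G : SimpleGraph (Fin M)) [DecidableRel G.Adj]
    (C : Fin M → Fin K → Multiset (EuclideanSpace ℝ (Fin p))) :
    (Fin M → Fin K → EuclideanSpace ℝ (Fin p)) →ₗ[ℝ]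
      (Fin M → Fin K → EuclideanSpace ℝ (Fin p)) where
  toFun u m k := ((1 / ρ) * ((C m k).card : ℝ) + (G.degree m : ℝ)) • u m k -
    ∑ l ∈ G.neighborFinset m, u l k
  map_add' u v := by
    ext m k : 2
    simp only [Pi.add_apply, smul_add, Finset.sum_add_distrib]
    abel
  map_smul' c u := by
    ext m k : 2
    simp only [Pi.smul_apply, RingHom.id_apply, smul_sub, Finset.smul_sum, smul_comm c]

/-- The scaled cell sums, i.e. minus the constant part of half the gradient of `costJ`. -/
def cellSum (ρ : ℝ) (C : Fin M → Fin K → Multiset (EuclideanSpace ℝ (Fin p))) :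
    Fin M → Fin K → EuclideanSpace ℝ (Fin p) :=
  fun m k => (1 / ρ) • (C m k).sum

variable (ρ : ℝ) (G : SimpleGraph (Fin M)) [DecidableRel G.Adj]
  (C : Fin M → Fin K → Multiset (EuclideanSpace ℝ (Fin p)))

theorem abs_centerInner_le (u v : Fin M → Fin K → EuclideanSpace ℝ (Fin p)) :
    |centerInner u v| ≤ (M * K : ℝ) * ‖u‖ * ‖v‖ := by
  have h : ∀ m k, |inner ℝ (u m k) (v m k)| ≤ ‖u‖ * ‖v‖ := fun m k =>
    (abs_real_inner_le_norm _ _).trans (mul_le_mul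
      ((norm_le_pi_norm (u m) k).trans (norm_le_pi_norm u m))
      ((norm_le_pi_norm (v m) k).trans (norm_le_pi_norm v m)) (norm_nonneg _) (norm_nonneg _))
  calc |centerInner u v| ≤ ∑ m, |∑ k, inner ℝ (u m k) (v m k)| := Finset.abs_sum_le_sum_abs _ _
    _ ≤ ∑ _m : Fin M, ∑ _k : Fin K, ‖u‖ * ‖v‖ := Finset.sum_le_sum fun m _ =>
      (Finset.abs_sum_le_sum_abs _ _).trans (Finset.sum_le_sum fun k _ => h m k)
    _ = _ := by simp; ring

theorem centerInner_costOp (u v : Fin M → Fin K → EuclideanSpace ℝ (Fin p)) :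
    centerInner (costOp ρ G C u) v =
      (1 / ρ) * ∑ m, ∑ k, ((C m k).card : ℝ) * inner ℝ (u m k) (v m k) +
      (1 / 2) * ∑ m, ∑ l ∈ G.neighborFinset m, ∑ k, inner ℝ (u m k - u l k) (v m k - v l k) := by
  have h1 : (1 / 2) * ∑ m, ∑ l ∈ G.neighborFinset m, ∑ k,
      inner ℝ (u m k - u l k) (v m k - v l k) =
      ∑ k, ∑ m, inner ℝ ((G.degree m : ℝ) • u m k - ∑ l ∈ G.neighborFinset m, u l k) (v m k) := by
    simp only [← G.half_sum_inner_sub_sub]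
    rw [← Finset.mul_sum, Finset.sum_comm (s := (Finset.univ : Finset (Fin K)))]
    congr 1
    exact Finset.sum_congr rfl fun m _ => Finset.sum_comm
  rw [h1, Finset.sum_comm (s := (Finset.univ : Finset (Fin K)))]
  simp only [centerInner, costOp, LinearMap.coe_mk, AddHom.coe_mk, Finset.mul_sum,
    ← Finset.sum_add_distrib]
  refine Finset.sum_congr rfl fun m _ => Finset.sum_congr rfl fun k _ => ?_
  simp only [inner_sub_left, inner_smul_left, conj_trivial]
  ring

theorem centerInner_costOp_comm (u v : Fin M → Fin K → EuclideanSpace ℝ (Fin p)) :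
    centerInner (costOp ρ G C u) v = centerInner (costOp ρ G C v) u := by
  simp only [centerInner_costOp, real_inner_comm]

theorem costJ_eq (x y : Fin M → Fin K → EuclideanSpace ℝ (Fin p)) :
    costJ ρ G y C = costJ ρ G x C + 2 * centerInner (costOp ρ G C x - cellSum ρ C) (y - x) +
      centerInner (costOp ρ G C (y - x)) (y - x) := by
  obtain ⟨e, rfl⟩ : ∃ e, y = x + e := ⟨y - x, by abel⟩
  rw [add_sub_cancel_left]
  have h1 : centerInner (costOp ρ G C x - cellSum ρ C) e =
      centerInner (costOp ρ G C x) e - centerInner (cellSum ρ C) e := by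
    simp only [centerInner, Pi.sub_apply, inner_sub_left, Finset.sum_sub_distrib]
  have h2 : centerInner (cellSum ρ C) e = (1 / ρ) * ∑ m, ∑ k, inner ℝ (C m k).sum (e m k) := by
    simp only [centerInner, cellSum, inner_smul_left, conj_trivial, Finset.mul_sum]
  have h3 : ∀ m l k, ‖(x + e) m k - (x + e) l k‖ ^ 2 = ‖x m k - x l k‖ ^ 2 +
      2 * inner ℝ (x m k - x l k) (e m k - e l k) +
      inner ℝ (e m k - e l k) (e m k - e l k) := by
    intro m l k
    rw [real_inner_self_eq_norm_sq, ← norm_add_sq_real]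
    simp only [Pi.add_apply]
    congr 2
    abel
  rw [h1, h2, centerInner_costOp, centerInner_costOp, costJ, costJ]
  simp only [h3]
  simp only [Pi.add_apply, Multiset.sum_sq_norm_sub_add, Finset.sum_add_distrib,
    inner_sub_left (𝕜 := ℝ) (_ • _), inner_smul_left, conj_trivial, ← Finset.mul_sum,
    Finset.sum_sub_distrib,
    real_inner_self_eq_norm_sq]
  ring

theorem costJ_nonneg (hρ : 0 < ρ) (x : Fin M → Fin K → EuclideanSpace ℝ (Fin p)) :
    0 ≤ costJ ρ G x C := by
  have h : ∀ m k, 0 ≤ ((C m k).map fun y => ‖y - x m k‖ ^ 2).sum := fun m k => by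
    refine Multiset.sum_nonneg fun a ha => ?_
    obtain ⟨y, -, rfl⟩ := Multiset.mem_map.1 ha
    positivity
  have h' : 0 ≤ ∑ m, ∑ k, ((C m k).map fun y => ‖y - x m k‖ ^ 2).sum :=
    Finset.sum_nonneg fun m _ => Finset.sum_nonneg fun k _ => h m k
  unfold costJ
  positivity

variable {ρ G C}

theorem costQ_le_costJ (hρ : 0 < ρ)
    {Dm : Fin M → Multiset (EuclideanSpace ℝ (Fin p))} (hC : ∀ m, IsKPartition (Dm m) (C m))
    (x : Fin M → Fin K → EuclideanSpace ℝ (Fin p)) : costQ ρ G Dm x ≤ costJ ρ G x C := by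
  unfold costQ costJ
  gcongr with m
  rw [← hC m, ← Multiset.coe_mapAddMonoidHom, map_sum, Multiset.sum_sum]
  gcongr with k
  refine Multiset.sum_map_le_sum_map _ _ fun y _ => ?_
  exact ciInf_le (Set.finite_range _).bddBelow k

theorem InVoronoi.costJ_eq_costQ {Dm : Fin M → Multiset (EuclideanSpace ℝ (Fin p))}
    {x : Fin M → Fin K → EuclideanSpace ℝ (Fin p)} (h : InVoronoi Dm x C) :
    costJ ρ G x C = costQ ρ G Dm x := by
  unfold costQ costJ
  congr 2
  refine Finset.sum_congr rfl fun m _ => ?_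
  rw [← h.1 m, ← Multiset.coe_mapAddMonoidHom, map_sum, Multiset.sum_sum]
  refine Finset.sum_congr rfl fun k _ => congrArg _ (Multiset.map_congr rfl fun y hy => ?_)
  have : Nonempty (Fin K) := ⟨k⟩
  refine le_antisymm (le_ciInf fun k' => ?_) (ciInf_le (Set.finite_range _).bddBelow k)
  gcongr
  exact h.2 m k y hy k'

theorem IsKPartition.le {D : Multiset (EuclideanSpace ℝ (Fin p))}
    {P : Fin K → Multiset (EuclideanSpace ℝ (Fin p))} (h : IsKPartition D P) (k : Fin K) :
    P k ≤ D := by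
  rw [← h]
  exact Finset.single_le_sum (fun _ _ => Multiset.zero_le _) (Finset.mem_univ k)

theorem finite_setOf_isKPartition (Dm : Fin M → Multiset (EuclideanSpace ℝ (Fin p))) :
    {C : Fin M → Fin K → Multiset (EuclideanSpace ℝ (Fin p)) |
      ∀ m, IsKPartition (Dm m) (C m)}.Finite := by
  classical
  refine (Set.Finite.pi fun m => Set.Finite.pi fun _ : Fin K => Set.finite_Iic (Dm m)).subset ?_
  exact fun C hC m _ k _ => (hC m).le k

theorem card_le_Nstar {Dm : Fin M → Multiset (EuclideanSpace ℝ (Fin p))}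
    (hC : ∀ m, IsKPartition (Dm m) (C m)) (m : Fin M) (k : Fin K) :
    (C m k).card ≤ Nstar Dm :=
  (Multiset.card_le_card ((hC m).le k)).trans
    (Finset.le_sup (f := fun m => (Dm m).card) (Finset.mem_univ m))

theorem centerInner_costOp_self_le (hρ : 0 < ρ)
    {Dm : Fin M → Multiset (EuclideanSpace ℝ (Fin p))} (hC : ∀ m, IsKPartition (Dm m) (C m))
    (u : Fin M → Fin K → EuclideanSpace ℝ (Fin p)) :
    centerInner (costOp ρ G C u) u ≤
      ((1 / ρ) * (Nstar Dm : ℝ) + lapLamMax G) * ∑ m, ∑ k, ‖u m k‖ ^ 2 := by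
  rw [centerInner_costOp, add_mul]
  simp only [real_inner_self_eq_norm_sq]
  gcongr ?_ + ?_
  · rw [mul_assoc]
    gcongr
    simp only [Finset.mul_sum]
    gcongr with m _ k _
    exact card_le_Nstar hC m k
  · have h1 : ∑ m, ∑ l ∈ G.neighborFinset m, ∑ k, ‖u m k - u l k‖ ^ 2 =
        ∑ k, ∑ m, ∑ l ∈ G.neighborFinset m, ‖u m k - u l k‖ ^ 2 := by
      rw [Finset.sum_comm (s := (Finset.univ : Finset (Fin K)))]
      exact Finset.sum_congr rfl fun m _ => Finset.sum_comm
    rw [h1, Finset.sum_comm (t := (Finset.univ : Finset (Fin K))), Finset.mul_sum, Finset.mul_sum]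
    exact Finset.sum_le_sum fun k _ => G.half_sum_sq_norm_sub_le fun m => u m k

theorem sq_norm_le_sum_sq_norm (u : Fin M → Fin K → EuclideanSpace ℝ (Fin p)) :
    ‖u‖ ^ 2 ≤ ∑ m, ∑ k, ‖u m k‖ ^ 2 := by
  have hσ : 0 ≤ ∑ m, ∑ k, ‖u m k‖ ^ 2 := by positivity
  refine (Real.le_sqrt (norm_nonneg u) hσ).1 ?_
  refine (pi_norm_le_iff_of_nonneg (Real.sqrt_nonneg _)).2 fun m =>
    (pi_norm_le_iff_of_nonneg (Real.sqrt_nonneg _)).2 fun k => Real.le_sqrt_of_sq_le ?_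
  exact (Finset.single_le_sum (f := fun k => ‖u m k‖ ^ 2) (fun _ _ => by positivity)
    (Finset.mem_univ k)).trans (Finset.single_le_sum (f := fun m => ∑ k, ‖u m k‖ ^ 2)
      (fun _ _ => by positivity) (Finset.mem_univ m))

theorem minDeg_le_degree (G : SimpleGraph (Fin M)) [DecidableRel G.Adj] (m : Fin M) :
    minDeg G ≤ G.degree m :=
  Nat.sInf_le ⟨m, rfl⟩

theorem StepOK.minDeg_pos {α : ℝ} (hM : 0 < M) (hρ : 0 < ρ)
    {Dm : Fin M → Multiset (EuclideanSpace ℝ (Fin p))} (hα : StepOK ρ α G Dm) :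
    0 < (minDeg G : ℝ) := by
  refine lt_of_le_of_lt ?_ hα.2
  have := lapLamMax_nonneg hM G
  have := hα.1
  positivity

theorem costOp_sub_cellSum_apply {α : ℝ} (hα : α ≠ 0)
    {x x' : Fin M → Fin K → EuclideanSpace ℝ (Fin p)} {m : Fin M} {k : Fin K}
    (hS : (1 / ρ) * ((C m k).card : ℝ) + (G.degree m : ℝ) ≠ 0)
    (hx : x' m k = x m k - α • (x m k - muVec ρ G x C m k)) :
    (costOp ρ G C x - cellSum ρ C) m k =
      -(((1 / ρ) * ((C m k).card : ℝ) + (G.degree m : ℝ)) / α) • (x' - x) m k := by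
  simp only [Pi.sub_apply, costOp, LinearMap.coe_mk, AddHom.coe_mk, cellSum, hx, muVec]
  rw [sub_sub_cancel_left, smul_neg, neg_smul, neg_neg, smul_smul, div_mul_cancel₀ _ hα, smul_sub,
    smul_smul, mul_inv_cancel₀ hS, one_smul]
  abel

theorem costJ_add_le_of_step {α : ℝ} (hρ : 0 < ρ)
    {Dm : Fin M → Multiset (EuclideanSpace ℝ (Fin p))} (hα : StepOK ρ α G Dm)
    (hC : ∀ m, IsKPartition (Dm m) (C m)) {x x' : Fin M → Fin K → EuclideanSpace ℝ (Fin p)}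
    (hx : ∀ m k, (costOp ρ G C x - cellSum ρ C) m k =
      -(((1 / ρ) * ((C m k).card : ℝ) + (G.degree m : ℝ)) / α) • (x' - x) m k) :
    costJ ρ G x' C + minDeg G / α * ‖x' - x‖ ^ 2 ≤ costJ ρ G x C := by
  have hα0 := hα.1
  set σ : ℝ := ∑ m, ∑ k, ‖(x' - x) m k‖ ^ 2 with hσ
  have hlin : centerInner (costOp ρ G C x - cellSum ρ C) (x' - x) ≤ -(minDeg G / α * σ) := by
    simp only [centerInner, hx, inner_smul_left, conj_trivial, real_inner_self_eq_norm_sq, hσ,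
      neg_mul, Finset.sum_neg_distrib, neg_le_neg_iff, Finset.mul_sum]
    gcongr with m _ k _
    have h1 : (minDeg G : ℝ) ≤ G.degree m := by exact_mod_cast minDeg_le_degree G m
    have h2 : 0 ≤ (1 / ρ) * ((C m k).card : ℝ) := by positivity
    linarith
  have hquad := centerInner_costOp_self_le (G := G) hρ hC (x' - x)
  have hstep : (1 / ρ) * (Nstar Dm : ℝ) + lapLamMax G ≤ minDeg G / α := by
    rw [le_div_iff₀ hα0, mul_comm]
    exact hα.2.le
  have hσ0 : 0 ≤ σ := by positivity
  have hquad' := hquad.trans (mul_le_mul_of_nonneg_right hstep hσ0)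
  have hnorm : minDeg G / α * ‖x' - x‖ ^ 2 ≤ minDeg G / α * σ := by
    gcongr
    exact sq_norm_le_sum_sq_norm _
  rw [costJ_eq ρ G C x x']
  linarith

theorem norm_costOp_sub_cellSum_le {α : ℝ} (hρ : 0 < ρ) (hα : 0 < α)
    {Dm : Fin M → Multiset (EuclideanSpace ℝ (Fin p))}
    (hC : ∀ m, IsKPartition (Dm m) (C m)) {x x' : Fin M → Fin K → EuclideanSpace ℝ (Fin p)}
    (hx : ∀ m k, (costOp ρ G C x - cellSum ρ C) m k =
      -(((1 / ρ) * ((C m k).card : ℝ) + (G.degree m : ℝ)) / α) • (x' - x) m k) :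
    ‖costOp ρ G C x - cellSum ρ C‖ ≤ ((1 / ρ) * (Nstar Dm : ℝ) + M) / α * ‖x' - x‖ := by
  refine (pi_norm_le_iff_of_nonneg (by positivity)).2 fun m =>
    (pi_norm_le_iff_of_nonneg (by positivity)).2 fun k => ?_
  have hdeg : G.degree m ≤ M := by simpa using (G.degree_lt_card_verts m).le
  rw [hx, norm_smul, norm_neg, Real.norm_of_nonneg (by positivity)]
  gcongr
  · exact card_le_Nstar hC m k
  · exact (norm_le_pi_norm ((x' - x) m) k).trans (norm_le_pi_norm (x' - x) m)

/-- Clusterings that are nearest-center for a convergent sequence of centers are eventually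
nearest-center for the limit. -/
theorem eventually_inVoronoi_of_tendsto {Dm : Fin M → Multiset (EuclideanSpace ℝ (Fin p))}
    {x : ℕ → Fin M → Fin K → EuclideanSpace ℝ (Fin p)}
    {z : Fin M → Fin K → EuclideanSpace ℝ (Fin p)}
    {C : ℕ → Fin M → Fin K → Multiset (EuclideanSpace ℝ (Fin p))}
    (hC : ∀ t, InVoronoi Dm (x t) (C t)) (hx : Filter.Tendsto x Filter.atTop (nhds z)) :
    ∀ᶠ t in Filter.atTop, InVoronoi Dm z (C t) := by
  have hxk : ∀ m k, Filter.Tendsto (fun t => x t m k) Filter.atTop (nhds (z m k)) := fun m k =>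
    tendsto_pi_nhds.1 (tendsto_pi_nhds.1 hx m) k
  have h : ∀ m k k', ∀ᶠ t in Filter.atTop, ∀ y ∈ {y | y ∈ Dm m},
      ‖z m k' - y‖ < ‖z m k - y‖ → ‖x t m k' - y‖ < ‖x t m k - y‖ := by
    intro m k k'
    have hfin : {y | y ∈ Dm m}.Finite := by
      classical
      exact (Dm m).toFinset.finite_toSet.subset fun y hy => by simpa using hy
    refine (Filter.eventually_all_finite hfin).2 fun y _ => ?_
    by_cases hlt : ‖z m k' - y‖ < ‖z m k - y‖
    · filter_upwards [((hxk m k').sub_const y).norm.eventually_lt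
        ((hxk m k).sub_const y).norm hlt] with t ht _ using ht
    · exact Filter.Eventually.of_forall fun _ h => absurd h hlt
  filter_upwards [Filter.eventually_all.2 fun m => Filter.eventually_all.2 fun k =>
    Filter.eventually_all.2 fun k' => h m k k'] with t ht
  refine ⟨(hC t).1, fun m k y hy k' => ?_⟩
  by_contra! hlt
  have h1 := ht m k k' y (Multiset.mem_of_le (((hC t).1 m).le k) hy)
    (by simpa only [norm_sub_rev y] using hlt)
  have h2 := (hC t).2 m k y hy k'
  rw [norm_sub_rev y, norm_sub_rev y] at h2
  exact absurd h1 h2.not_gt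

end NKMeans

/-- Theorem 3: any trajectory of the NK-means algorithm converges to
a generalized Lloyd's minimum `x̆ ∈ M^ρ`, and the clusterings enter the set `U_x̆` of
optimal clusterings under `x̆` in finite time. -/
theorem stmt6 {p K M : ℕ} (hK2 : 2 ≤ K)
    (Dm : Fin M → Multiset (EuclideanSpace ℝ (Fin p)))
    (D : Multiset (EuclideanSpace ℝ (Fin p))) (hD : ∑ m, Dm m = D)
    (hdistinct : HasKDistinct K D)
    (G : SimpleGraph (Fin M)) [DecidableRel G.Adj] (hconn : G.Connected)
    (ρ α : ℝ) (hρ : 0 < ρ) (hα : StepOK ρ α G Dm)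
    (x : ℕ → Fin M → Fin K → EuclideanSpace ℝ (Fin p))
    (C : ℕ → Fin M → Fin K → Multiset (EuclideanSpace ℝ (Fin p)))
    (hseq : NKMeansSeq ρ α G Dm x C) :
    ∃ xlim : Fin M → Fin K → EuclideanSpace ℝ (Fin p),
      xlim ∈ genM ρ G Dm K ∧
      Filter.Tendsto x Filter.atTop (nhds xlim) ∧
      ∃ T : ℕ, 0 < T ∧ ∀ t, T ≤ t → InVoronoi Dm xlim (C t) := by
  have hM : 0 < M := Fin.pos_iff_nonempty.2 hconn.nonempty
  have hdmin := hα.minDeg_pos hM hρ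
  have hpart : ∀ t m, IsKPartition (Dm m) (C (t + 1) m) := fun t => (hseq.2 t).1
  have hvor : ∀ t, InVoronoi Dm (x t) (C (t + 1)) := fun t => ⟨hpart t, (hseq.2 t).2.1⟩
  have hgrad : ∀ t m k, (costOp ρ G (C (t + 1)) (x t) - cellSum ρ (C (t + 1))) m k =
      -(((1 / ρ) * ((C (t + 1) m k).card : ℝ) + (G.degree m : ℝ)) / α) •
        (x (t + 1) - x t) m k := fun t m k => by
    refine costOp_sub_cellSum_apply hα.1.ne' (ne_of_gt ?_) ((hseq.2 t).2.2 m k)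
    have h1 : (minDeg G : ℝ) ≤ G.degree m := by exact_mod_cast minDeg_le_degree G m
    have h2 : 0 ≤ (1 / ρ) * ((C (t + 1) m k).card : ℝ) := by positivity
    linarith
  obtain ⟨z, j, hz, hj, hfreq⟩ := exists_tendsto_of_piecewise_quadratic_descent
    abs_centerInner_le (f := fun C x => costJ ρ G x C) (A := costOp ρ G) (b := cellSum ρ)
    (fun C => centerInner_costOp_comm ρ G C) (fun C => costJ_eq ρ G C) (x := x)
    (i := fun t => C (t + 1))
    ((finite_setOf_isKPartition Dm).subset (Set.range_subset_iff.2 hpart))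
    (div_pos hdmin hα.1) (fun t => costJ_nonneg ρ G _ hρ _)
    (fun t => (add_le_add_left ((hvor (t + 1)).costJ_eq_costQ.trans_le
      (costQ_le_costJ hρ (hpart t) _)) _).trans
        (costJ_add_le_of_step hρ hα (hpart t) (hgrad t)))
    (fun t => norm_costOp_sub_cellSum_le hρ hα.1 (hpart t) (hgrad t))
  have hev := eventually_inVoronoi_of_tendsto hvor hz
  refine ⟨z, ⟨j, ?_, fun m k => ?_⟩, hz, ?_⟩
  · obtain ⟨t, rfl, ht⟩ := (hfreq.and_eventually hev).exists
    exact ht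
  · exact sub_eq_iff_eq_add.1 (congrFun (congrFun hj m) k)
  · obtain ⟨T, hT⟩ := Filter.eventually_atTop.1 hev
    refine ⟨T + 1, T.succ_pos, fun t ht => ?_⟩
    obtain ⟨s, rfl⟩ : ∃ s, t = s + 1 := ⟨t - 1, by omega⟩
    exact hT s (by omega)
end
end

section
/- Let the dataset contain at least K distinct points and the communication graph be connected. Then there exists ρ̄ > 0 such that for every ρ ≥ ρ̄ the following holds: if (x̆^ρ, C̆^ρ) is a generalized Lloyd's minimum of J^ρ with x̆^ρ ∈ M̄^ρ, and P̆^ρ = (P̆^{ρ,1},…,P̆^{ρ,K}) is the partition of D defined by P̆^{ρ,k} = C̆_1^{ρ,k} ∪ … ∪ C̆_M^{ρ,k}, then P̆^ρ is cost-equivalent to a classical Lloyd's minimum: there exists a Lloyd's minimum pair (x, P) ∈ 𝓛 such that H(x, P) = H(x, P̆^ρ). -/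
open scoped BigOperators

noncomputable section

/-- Expansion of the sum of squared distances to `c'` around another point `c`. -/
theorem sum_sq_dist_expand {E : Type*} [NormedAddCommGroup E] [InnerProductSpace ℝ E]
    (s : Multiset E) (c c' : E) :
    (s.map fun y => ‖y - c'‖ ^ 2).sum =
      (s.map fun y => ‖y - c‖ ^ 2).sum + (s.card : ℝ) * ‖c - c'‖ ^ 2 +
        2 * inner ℝ (s.sum - (s.card : ℝ) • c) (c - c') := by
  induction s using Multiset.induction_on with
  | empty => simp
  | cons a s ih =>
    have hsplit : ‖a - c'‖ ^ 2 = ‖a - c‖ ^ 2 + 2 * inner ℝ (a - c) (c - c') + ‖c - c'‖ ^ 2 := by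
      rw [← norm_add_sq_real, sub_add_sub_cancel]
    have hinner : inner ℝ (a + s.sum - ((s.card : ℝ) + 1) • c) (c - c') =
        inner ℝ (s.sum - (s.card : ℝ) • c) (c - c') + inner ℝ (a - c) (c - c') := by
      rw [← inner_add_left]
      congr 1
      module
    simp only [Multiset.map_cons, Multiset.sum_cons, Multiset.card_cons, Nat.cast_add, Nat.cast_one]
    rw [ih, hsplit, hinner]
    ring

/-- A nearest-center partition whose centers are centroids is a Lloyd's minimum. -/
theorem isLloydMin_of_voronoi_of_centroid {p K : ℕ}
    {D : Multiset (EuclideanSpace ℝ (Fin p))} {z : Fin K → EuclideanSpace ℝ (Fin p)}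
    {P : Fin K → Multiset (EuclideanSpace ℝ (Fin p))} (hP : IsKPartition D P)
    (hvor : ∀ k, ∀ y ∈ P k, ∀ k', ‖y - z k‖ ≤ ‖y - z k'‖)
    (hcen : ∀ k, ((P k).card : ℝ) • z k = (P k).sum) : IsLloydMin D z P := by
  refine ⟨hP, fun Q hQ => ?_, fun x' => Finset.sum_le_sum fun k _ => ?_⟩
  · have hsum : ∀ R : Fin K → Multiset (EuclideanSpace ℝ (Fin p)), IsKPartition D R →
        ∑ k, ((R k).map fun y => ⨅ j, ‖y - z j‖ ^ 2).sum = kmeansF K D z := by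
      intro R hR
      rw [kmeansF, ← hR, ← Multiset.coe_mapAddMonoidHom, map_sum, ← Multiset.coe_sumAddMonoidHom,
        map_sum]
    calc costH z P ≤ ∑ k, ((P k).map fun y => ⨅ j, ‖y - z j‖ ^ 2).sum := by
          refine Finset.sum_le_sum fun k _ => Multiset.sum_map_le_sum_map _ _ fun y hy => ?_
          have : Nonempty (Fin K) := ⟨k⟩
          exact le_ciInf fun j => pow_le_pow_left₀ (norm_nonneg _) (hvor k y hy j) 2
      _ = ∑ k, ((Q k).map fun y => ⨅ j, ‖y - z j‖ ^ 2).sum := by rw [hsum P hP, hsum Q hQ]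
      _ ≤ costH z Q := Finset.sum_le_sum fun k _ => Multiset.sum_map_le_sum_map _ _ fun y _ =>
          ciInf_le (Set.finite_range _).bddBelow k
  · rw [sum_sq_dist_expand (P k) (z k) (x' k), hcen k, sub_self, inner_zero_left, mul_zero,
      add_zero]
    exact le_add_of_nonneg_right (by positivity)

/-- A vector-valued harmonic function on a connected finite graph is constant. -/
theorem eq_of_degree_smul_eq_sum_neighbors {p M : ℕ} {G : SimpleGraph (Fin M)}
    [DecidableRel G.Adj] (hconn : G.Connected) {f : Fin M → EuclideanSpace ℝ (Fin p)}
    (hf : ∀ m, (G.degree m : ℝ) • f m = ∑ l ∈ G.neighborFinset m, f l) (m n : Fin M) :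
    f m = f n := by
  ext i
  refine (G.lapMatrix_mulVec_eq_zero_iff_forall_reachable (x := fun m => f m i)).1 ?_ m n
    (hconn.preconnected m n)
  ext m
  have h := congrArg (fun v : EuclideanSpace ℝ (Fin p) => v i) (hf m)
  simp only [PiLp.smul_apply, smul_eq_mul, WithLp.ofLp_sum, Finset.sum_apply] at h
  rw [SimpleGraph.lapMatrix_mulVec_apply, h, sub_self, Pi.zero_apply]

/-- The stationarity equations, summed over the agents, are free of the agreement terms. -/
theorem IsFixedCenters.sum_card_smul {p K M : ℕ} {ρ : ℝ} (hρ : ρ ≠ 0) {G : SimpleGraph (Fin M)}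
    [DecidableRel G.Adj] {x : Fin M → Fin K → EuclideanSpace ℝ (Fin p)}
    {C : Fin M → Fin K → Multiset (EuclideanSpace ℝ (Fin p))} (h : IsFixedCenters ρ G x C)
    (k : Fin K) : ∑ m, ((C m k).card : ℝ) • x m k = ∑ m, (C m k).sum := by
  have hsymm : ∑ m, ∑ l ∈ G.neighborFinset m, x l k = ∑ m, (G.degree m : ℝ) • x m k := by
    rw [Finset.sum_comm' (t' := Finset.univ) (s' := fun l => G.neighborFinset l)
      (by simp [SimpleGraph.adj_comm])]
    simp [Nat.cast_smul_eq_nsmul]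
  have hsum := Finset.sum_congr (rfl : (Finset.univ : Finset (Fin M)) = _) fun m _ => h m k
  simp only [add_smul, Finset.sum_add_distrib, hsymm, add_left_inj, mul_smul,
    ← Finset.smul_sum] at hsum
  exact smul_right_injective _ (one_div_ne_zero hρ) hsum

/-- For a fixed clustering, if generalized Lloyd's minima with bounded centers exist for
arbitrarily large `ρ`, then the aggregated partition belongs to a Lloyd's minimum. -/
theorem exists_isLloydMin_of_frequently_isGenLloydMin {p K M : ℕ}
    {Dm : Fin M → Multiset (EuclideanSpace ℝ (Fin p))}
    {G : SimpleGraph (Fin M)} [DecidableRel G.Adj] (hconn : G.Connected)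
    {C : Fin M → Fin K → Multiset (EuclideanSpace ℝ (Fin p))}
    {S : Set (EuclideanSpace ℝ (Fin p))} (hS : IsCompact S)
    (h : ∀ r : ℝ, ∃ ρ, r ≤ ρ ∧ ∃ x, IsGenLloydMin ρ G Dm x C ∧ ∀ m k, x m k ∈ S) :
    ∃ z, IsLloydMin (∑ m, Dm m) z fun k => ∑ m, C m k := by
  choose ρ hρ x hx hxS using fun n : ℕ => h (n + 1)
  have hρ0 : ∀ n, ρ n ≠ 0 := fun n => by
    have := hρ n
    exact (by positivity : (0 : ℝ) < n + 1).trans_le this |>.ne'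
  have hρinf : Filter.Tendsto ρ Filter.atTop Filter.atTop :=
    Filter.tendsto_atTop_mono (fun n => (by linarith [hρ n] : (n : ℝ) ≤ ρ n))
      tendsto_natCast_atTop_atTop
  obtain ⟨w, -, φ, hφ, hlim⟩ := (isCompact_univ_pi fun _ : Fin M =>
    isCompact_univ_pi fun _ : Fin K => hS).tendsto_subseq
      (x := x) fun n m _ k _ => hxS n m k
  have hw : ∀ m k, Filter.Tendsto (fun n => x (φ n) m k) Filter.atTop (nhds (w m k)) :=
    fun m k => (tendsto_pi_nhds.1 ((tendsto_pi_nhds.1 hlim) m)) k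
  have hinv : Filter.Tendsto (fun n => 1 / ρ (φ n)) Filter.atTop (nhds 0) := by
    simp only [one_div]
    exact (hρinf.comp hφ.tendsto_atTop).inv_tendsto_atTop
  have hharm : ∀ k m, (G.degree m : ℝ) • w m k = ∑ l ∈ G.neighborFinset m, w l k := by
    intro k m
    have hl := ((hinv.mul_const ((C m k).card : ℝ)).add_const (G.degree m : ℝ)).smul (hw m k)
    have hr := (hinv.smul_const (C m k).sum).add
      (tendsto_finsetSum (G.neighborFinset m) fun l _ => hw l k)
    simp only [zero_mul, zero_add, zero_smul] at hl hr
    exact tendsto_nhds_unique (hl.congr fun n => (hx (φ n)).2 m k) hr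
  obtain ⟨m₀⟩ := hconn.nonempty
  have hconst : ∀ m k, w m k = w m₀ k := fun m k =>
    eq_of_degree_smul_eq_sum_neighbors hconn (hharm k) m m₀
  refine ⟨w m₀, isLloydMin_of_voronoi_of_centroid ?_ (fun k y hy k' => ?_) fun k => ?_⟩
  · rw [IsKPartition, Finset.sum_comm]
    exact Finset.sum_congr rfl fun m _ => (hx 0).1.1 m
  · obtain ⟨m, -, hm⟩ := Multiset.mem_sum.1 hy
    rw [← hconst m k, ← hconst m k']
    exact le_of_tendsto_of_tendsto' ((hw m k).const_sub y).norm ((hw m k').const_sub y).norm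
      fun n => (hx (φ n)).1.2 m k y hm k'
  · have hsum : ∑ m, ((C m k).card : ℝ) • w m k = ∑ m, (C m k).sum :=
      tendsto_nhds_unique
        (tendsto_finsetSum Finset.univ fun m _ => (hw m k).const_smul ((C m k).card : ℝ))
        (tendsto_const_nhds.congr fun n => ((hx (φ n)).2.sum_card_smul (hρ0 _) k).symm)
    simp only [hconst _ k, ← Finset.sum_smul] at hsum
    rw [Multiset.card_sum, Nat.cast_sum, hsum, ← Multiset.coe_sumAddMonoidHom, map_sum]

/-- A family of datasets has only finitely many families of partitions. -/
theorem finite_setOf_forall_isKPartition {p K M : ℕ}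
    (Dm : Fin M → Multiset (EuclideanSpace ℝ (Fin p))) :
    {C : Fin M → Fin K → Multiset (EuclideanSpace ℝ (Fin p)) |
      ∀ m, IsKPartition (Dm m) (C m)}.Finite := by
  classical
  refine (Set.Finite.pi' fun m => Set.Finite.pi' fun _ : Fin K =>
    Set.finite_Iic (Dm m)).subset fun C hC m k => ?_
  rw [Set.mem_Iic, ← hC m]
  exact Finset.single_le_sum (f := C m) (fun _ _ => Multiset.zero_le _) (Finset.mem_univ k)

/-- Corollary 1, finite-`ρ` convergence of clusters: there exists
`ρ̄ > 0` such that for all `ρ ≥ ρ̄`, the aggregated partition of any generalized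
Lloyd's minimum in `M̄^ρ` is cost-equivalent to a classical Lloyd's minimum. -/
theorem stmt7 {p K M : ℕ} (hK2 : 2 ≤ K)
    (Dm : Fin M → Multiset (EuclideanSpace ℝ (Fin p)))
    (D : Multiset (EuclideanSpace ℝ (Fin p))) (hD : ∑ m, Dm m = D)
    (hdistinct : HasKDistinct K D)
    (G : SimpleGraph (Fin M)) [DecidableRel G.Adj] (hconn : G.Connected) :
    ∃ ρbar : ℝ, 0 < ρbar ∧ ∀ ρ : ℝ, ρbar ≤ ρ →
      ∀ (x : Fin M → Fin K → EuclideanSpace ℝ (Fin p))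
        (C : Fin M → Fin K → Multiset (EuclideanSpace ℝ (Fin p))),
        IsGenLloydMin ρ G Dm x C →
        (∀ m k, x m k ∈ convexHull ℝ {y | y ∈ D}) →
        ∃ (z : Fin K → EuclideanSpace ℝ (Fin p))
          (P : Fin K → Multiset (EuclideanSpace ℝ (Fin p))),
          IsLloydMin D z P ∧ costH z P = costH z (fun k => ∑ m, C m k) := by
  set S := convexHull ℝ {y | y ∈ D}
  have hS : IsCompact S := by
    classical
    exact (D.toFinset.finite_toSet.subset fun _ hy =>
      Multiset.mem_toFinset.2 hy).isCompact_convexHull ℝ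
  have hbound : ∀ C : Fin M → Fin K → Multiset (EuclideanSpace ℝ (Fin p)), ∃ r : ℝ,
      ∀ ρ, r ≤ ρ → ∀ x, IsGenLloydMin ρ G Dm x C → (∀ m k, x m k ∈ S) →
        ∃ z, IsLloydMin D z fun k => ∑ m, C m k := by
    intro C
    by_cases hC : ∃ z, IsLloydMin D z fun k => ∑ m, C m k
    · exact ⟨0, fun _ _ _ _ _ => hC⟩
    · contrapose! hC
      rw [← hD]
      refine exists_isLloydMin_of_frequently_isGenLloydMin (Dm := Dm) hconn hS fun r => ?_
      obtain ⟨ρ, hρ, x, hx, hxS, -⟩ := hC r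
      exact ⟨ρ, hρ, x, hx, hxS⟩
  choose r hr using hbound
  obtain ⟨b, hb⟩ := ((finite_setOf_forall_isKPartition (K := K) Dm).image r).bddAbove
  refine ⟨max b 1, by positivity, fun ρ hρ x C hx hxS => ?_⟩
  obtain ⟨z, hz⟩ := hr C ρ
    ((hb (Set.mem_image_of_mem r hx.1.1)).trans ((le_max_left b 1).trans hρ)) x hx hxS
  exact ⟨z, _, hz, rfl⟩
end
end

section
/- Let (x_t, C_t) be the sequence generated by the NK-means algorithm with step size α satisfying 0 < α < d_min/((1/ρ)N* + λ_M(L)). Let co(x_0, D) denote the closed convex hull of the set of all data points in D together with all initial centers x_m^k(0), m = 1,…,M, k = 1,…,K. Then x_m^k(t) ∈ co(x_0, D) for all m, k, and all t ≥ 0. -/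
open scoped BigOperators

noncomputable section

open scoped Pointwise in
theorem multiset_sum_mem_card_smul {E : Type*} [AddCommGroup E] [Module ℝ E] {S : Set E}
    (hS : Convex ℝ S) (hne : S.Nonempty) (T : Multiset E) (hT : ∀ y ∈ T, y ∈ S) :
    T.sum ∈ (T.card : ℝ) • S := by
  induction T using Multiset.induction_on with
  | empty => simp [Set.zero_smul_set hne]
  | cons a T ih =>
    rw [Multiset.sum_cons, Multiset.card_cons, Nat.cast_add, Nat.cast_one, add_comm (_ : ℝ) 1,
      hS.add_smul zero_le_one (Nat.cast_nonneg _), one_smul]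
    exact Set.add_mem_add (hT a (Multiset.mem_cons_self a T))
      (ih fun y hy => hT y (Multiset.mem_cons_of_mem hy))

/-- The average vertex degree, hence the minimum degree, is at most the largest Laplacian
eigenvalue. -/
theorem minDeg_le_lapLamMax {M : ℕ} [NeZero M] (G : SimpleGraph (Fin M)) [DecidableRel G.Adj] :
    (minDeg G : ℝ) ≤ lapLamMax G := by
  have hH : (G.lapMatrix ℝ).IsHermitian := (G.posSemidef_lapMatrix ℝ).isHermitian
  have heig : ∀ i, hH.eigenvalues i ≤ lapLamMax G := fun i => by
    refine le_csSup ?_ (hH.eigenvalues_mem_spectrum_real i)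
    rw [hH.spectrum_real_eq_range_eigenvalues]
    exact (Set.finite_range _).bddAbove
  have htr : ∑ m, (G.degree m : ℝ) = ∑ i, hH.eigenvalues i := by
    have h := hH.trace_eq_sum_eigenvalues
    simpa [Matrix.trace, SimpleGraph.lapMatrix, SimpleGraph.degMatrix] using h
  have hdeg : ∀ m, (minDeg G : ℝ) ≤ G.degree m := fun m => by
    exact_mod_cast Nat.sInf_le (Set.mem_range_self m)
  have hle : (M : ℝ) * minDeg G ≤ M * lapLamMax G := calc
    (M : ℝ) * minDeg G = ∑ _m : Fin M, (minDeg G : ℝ) := by simp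
    _ ≤ ∑ m, (G.degree m : ℝ) := Finset.sum_le_sum fun m _ => hdeg m
    _ = ∑ i, hH.eigenvalues i := htr
    _ ≤ ∑ _i : Fin M, lapLamMax G := Finset.sum_le_sum fun i _ => heig i
    _ = M * lapLamMax G := by simp
  exact le_of_mul_le_mul_left hle (Nat.cast_pos.2 (NeZero.pos M))

theorem StepOK.minDeg_pos_and_lt_one {p M : ℕ} [NeZero M] {ρ α : ℝ} (hρ : 0 < ρ)
    {G : SimpleGraph (Fin M)} [DecidableRel G.Adj]
    {Dm : Fin M → Multiset (EuclideanSpace ℝ (Fin p))} (h : StepOK ρ α G Dm) :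
    (0 : ℝ) < minDeg G ∧ α < 1 := by
  obtain ⟨hα, hlt⟩ := h
  have hlam := minDeg_le_lapLamMax G
  have hd : (0 : ℝ) ≤ minDeg G := Nat.cast_nonneg _
  have hN : 0 ≤ (1 / ρ) * (Nstar Dm : ℝ) := by positivity
  have hsum : 0 ≤ (1 / ρ) * (Nstar Dm : ℝ) + lapLamMax G := by linarith
  refine ⟨(mul_nonneg hα.le hsum).trans_lt hlt, ?_⟩
  by_contra! h1
  linarith [le_mul_of_one_le_left hsum h1]

open scoped Pointwise in
theorem muVec_mem_of_convex {p K M : ℕ} {ρ : ℝ} (hρ : 0 < ρ) (G : SimpleGraph (Fin M))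
    [DecidableRel G.Adj] {x : Fin M → Fin K → EuclideanSpace ℝ (Fin p)}
    {C : Fin M → Fin K → Multiset (EuclideanSpace ℝ (Fin p))} {m : Fin M} {k : Fin K}
    {S : Set (EuclideanSpace ℝ (Fin p))} (hS : Convex ℝ S) (hdeg : 0 < G.degree m)
    (hx : ∀ l, x l k ∈ S) (hC : ∀ y ∈ C m k, y ∈ S) : muVec ρ G x C m k ∈ S := by
  have hpos : 0 < (1 / ρ) * ((C m k).card : ℝ) + (G.degree m : ℝ) := by positivity
  have hne : S.Nonempty := ⟨_, hx m⟩
  have hcell : (1 / ρ) • (C m k).sum ∈ ((1 / ρ) * ((C m k).card : ℝ)) • S := by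
    rw [mul_smul]
    exact Set.smul_mem_smul_set (multiset_sum_mem_card_smul hS hne _ hC)
  have hnbr : ∑ l ∈ G.neighborFinset m, x l k ∈ (G.degree m : ℝ) • S := by
    have h := multiset_sum_mem_card_smul hS hne
      ((G.neighborFinset m).val.map fun l => x l k) (by simp [hx])
    rwa [Multiset.card_map, Finset.card_val, G.card_neighborFinset_eq_degree] at h
  rw [muVec, ← Set.mem_smul_set_iff_inv_smul_mem₀ hpos.ne',
    hS.add_smul (by positivity) (Nat.cast_nonneg _)]
  exact Set.add_mem_add hcell hnbr

/-- Proposition 3, boundedness of the iterates: every center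
produced by the NK-means algorithm remains in the closed convex hull of the data
points together with the initial centers. -/
theorem stmt10 {p K M : ℕ}
    (Dm : Fin M → Multiset (EuclideanSpace ℝ (Fin p)))
    (D : Multiset (EuclideanSpace ℝ (Fin p))) (hD : ∑ m, Dm m = D)
    (G : SimpleGraph (Fin M)) [DecidableRel G.Adj] (hconn : G.Connected)
    (ρ α : ℝ) (hρ : 0 < ρ) (hα : StepOK ρ α G Dm)
    (x : ℕ → Fin M → Fin K → EuclideanSpace ℝ (Fin p))
    (C : ℕ → Fin M → Fin K → Multiset (EuclideanSpace ℝ (Fin p)))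
    (hseq : NKMeansSeq ρ α G Dm x C) :
    ∀ (t : ℕ) (m : Fin M) (k : Fin K),
      x t m k ∈ convexHull ℝ ({y | y ∈ D} ∪ {v | ∃ m' k', v = x 0 m' k'}) := by
  have : NeZero M := ⟨fun h => by
    subst h
    exact hconn.nonempty.elim Fin.elim0⟩
  obtain ⟨hd, hα1⟩ := hα.minDeg_pos_and_lt_one hρ
  have hS := convex_convexHull ℝ ({y | y ∈ D} ∪ {v | ∃ m' k', v = x 0 m' k'})
  intro t
  induction t with
  | zero => exact fun m k => subset_convexHull ℝ _ (Or.inr ⟨m, k, rfl⟩)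
  | succ t ih =>
    intro m k
    obtain ⟨hpart, -, hupd⟩ := hseq.2 t
    have hcell : ∀ y ∈ C (t + 1) m k, y ∈ D := fun y hy => by
      have hym : y ∈ Dm m := by
        rw [← hpart m]
        exact Multiset.mem_sum.2 ⟨k, Finset.mem_univ k, hy⟩
      rw [← hD]
      exact Multiset.mem_sum.2 ⟨m, Finset.mem_univ m, hym⟩
    have hdeg : 0 < G.degree m :=
      (Nat.cast_pos.1 hd).trans_le (Nat.sInf_le (Set.mem_range_self m))
    have hmu := muVec_mem_of_convex hρ G hS hdeg (fun l => ih l k)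
      fun y hy => subset_convexHull ℝ _ (Or.inl (hcell y hy))
    have hcomb : x (t + 1) m k =
        (1 - α) • x t m k + α • muVec ρ G (x t) (C (t + 1)) m k := by
      rw [hupd m k]
      module
    rw [hcomb]
    exact hS (ih m k) hmu (sub_nonneg.2 hα1.le) hα.1.le (sub_add_cancel 1 α)
end
end
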